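/- For each positive integer n, let c_n = (1/2)(r₁(n) − r₂(n)), where r₁(n) = #{(m,k) ∈ ℤ² : m² + mk + 6k² = n} and r₂(n) = #{(m,k) ∈ ℤ² : 2m² + mk + 3k² = n}. Then the series φ(x) = ∑_{n=1}^∞ (c_n / n) e(nx) converges uniformly on ℝ to a continuous 1-periodic function, and for every β with 0 < β < 1/2, φ is Hölder continuous of index β. -/

import Mathlib

open Complex Filter Finset

/-- `e x = exp(2 π i x)` -/
noncomputable def e (t : ℝ) : ℂ := Complex.exp (2 * Real.pi * Complex.I * t)

/-- The number of representations of `n` by the quadratic form `m² + mk + 6k²`. -/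
noncomputable def r₁ (n : ℕ) : ℕ :=
  {p : ℤ × ℤ | p.1 ^ 2 + p.1 * p.2 + 6 * p.2 ^ 2 = n}.ncard

/-- The number of representations of `n` by the quadratic form `2m² + mk + 3k²`. -/
noncomputable def r₂ (n : ℕ) : ℕ :=
  {p : ℤ × ℤ | 2 * p.1 ^ 2 + p.1 * p.2 + 3 * p.2 ^ 2 = n}.ncard

/-- The Fourier coefficients of the weight-one cusp form for Γ₀(23). -/
noncomputable def c (n : ℕ) : ℝ := ((r₁ n : ℝ) - (r₂ n : ℝ)) / 2

lemma norm_e (t : ℝ) : ‖e t‖ = 1 := by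
  have : (2 * Real.pi * Complex.I * t : ℂ) = ((2 * Real.pi * t : ℝ) : ℂ) * Complex.I := by
    push_cast; ring
  rw [e, this, Complex.norm_exp_ofReal_mul_I]

lemma e_add (s t : ℝ) : e (s + t) = e s * e t := by
  rw [e, e, e, ← Complex.exp_add]; push_cast; ring_nf

lemma e_natCast (n : ℕ) : e n = 1 := by
  rw [e, Complex.exp_eq_one_iff]
  exact ⟨n, by push_cast; ring⟩

lemma hasDerivAt_e_mul (r x : ℝ) :
    HasDerivAt (fun x : ℝ => e (r * x)) (2 * Real.pi * Complex.I * r * e (r * x)) x := by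
  have h : HasDerivAt (fun x : ℝ => (2 * Real.pi * Complex.I * ((r * x : ℝ) : ℂ)))
      (2 * Real.pi * Complex.I * r) x := by
    simpa using (((hasDerivAt_id x).const_mul r).ofReal_comp).const_mul (2 * Real.pi * Complex.I)
  simpa [e, mul_comm] using h.cexp

lemma continuous_e : Continuous e := by
  unfold e; fun_prop

lemma sum_div_sub_div_eq (u : ℕ → ℂ) (N : ℕ) :
    ∑ n ∈ Icc 1 N, u n / n - (∑ n ∈ Icc 1 N, u n) / (N + 1) =
      ∑ n ∈ Icc 1 N, (∑ k ∈ Icc 1 n, u k) / (n * (n + 1)) := by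
  induction N with
  | zero => simp
  | succ N ih =>
    rw [sum_Icc_succ_top (by simp), sum_Icc_succ_top (by simp), sum_Icc_succ_top (by simp), ← ih,
      sum_Icc_succ_top (by simp)]
    have h1 : (N + 1 : ℂ) ≠ 0 := by exact_mod_cast Nat.succ_ne_zero N
    have h2 : (N + 1 + 1 : ℂ) ≠ 0 := by exact_mod_cast Nat.succ_ne_zero (N + 1)
    push_cast
    field_simp
    ring

lemma rpow_neg_div_succ_le {p : ℝ} (hp : 0 < p) (hp1 : p ≤ 1) {n : ℕ} (hn : 1 ≤ n) :
    (n : ℝ) ^ (-p) / (n + 1) ≤ ((n : ℝ) ^ (-p) - ((n + 1 : ℕ) : ℝ) ^ (-p)) / p := by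
  have hn0 : (0 : ℝ) < n := by exact_mod_cast hn
  have hB := rpow_one_add_le_one_add_mul_self (s := -1 / (n + 1 : ℝ))
    (by rw [le_div_iff₀ (by positivity)]; linarith) hp.le hp1
  have h1 : 1 + -1 / (n + 1 : ℝ) = n / (n + 1) := by field_simp; ring
  rw [h1, Real.div_rpow hn0.le (by positivity)] at hB
  have h2 : ((n + 1 : ℕ) : ℝ) ^ (-p) = (n : ℝ) ^ (-p) * ((n : ℝ) ^ p / (n + 1 : ℝ) ^ p) := by
    rw [Real.rpow_neg (by positivity), Real.rpow_neg hn0.le]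
    have : (n : ℝ) ^ p ≠ 0 := by positivity
    push_cast
    field_simp
  rw [h2, le_div_iff₀ hp]
  have := mul_le_mul_of_nonneg_left hB (Real.rpow_nonneg hn0.le (-p))
  have h3 : (n : ℝ) ^ (-p) * (1 + p * (-1 / (n + 1))) = (n : ℝ) ^ (-p) - (n : ℝ) ^ (-p) / (n + 1) * p := by
    ring
  linarith

/-- If the partial sums of `u` are `O(N ^ (1 - p))`, the series `∑ u n / n` is Cauchy with rate
`N ^ (-p)`. -/
lemma norm_sum_div_sub_le {p C : ℝ} (hp : 0 < p) (hp1 : p ≤ 1) (u : ℕ → ℂ)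
    (hu : ∀ N : ℕ, 1 ≤ N → ‖∑ n ∈ Icc 1 N, u n‖ ≤ C * (N : ℝ) ^ (1 - p)) {M N : ℕ} (hM : 1 ≤ M)
    (hMN : M ≤ N) :
    ‖∑ n ∈ Icc 1 N, u n / n - ∑ n ∈ Icc 1 M, u n / n‖ ≤ C * (2 + 1 / p) * (M : ℝ) ^ (-p) := by
  have hC : 0 ≤ C := by simpa using (norm_nonneg _).trans (hu 1 le_rfl)
  have hpow (n : ℕ) (hn : 1 ≤ n) : (n : ℝ) ^ (1 - p) = n * (n : ℝ) ^ (-p) := by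
    rw [sub_eq_add_neg, Real.rpow_add (by positivity), Real.rpow_one]
  have hend (n : ℕ) (hn : M ≤ n) : ‖(∑ k ∈ Icc 1 n, u k) / (n + 1)‖ ≤ C * (M : ℝ) ^ (-p) := by
    have hn1 := hM.trans hn
    have hn0 : (0 : ℝ) < n := by exact_mod_cast hn1
    have : ‖((n : ℂ) + 1)‖ = n + 1 := by exact_mod_cast Complex.norm_natCast (n + 1)
    rw [norm_div, this, div_le_iff₀ (by positivity)]
    refine (hu n hn1).trans ?_
    rw [hpow n hn1]
    have h1 : (n : ℝ) ^ (-p) ≤ (M : ℝ) ^ (-p) :=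
      Real.rpow_le_rpow_of_nonpos (by exact_mod_cast hM) (by exact_mod_cast hn) (by linarith)
    have h2 : 0 ≤ (M : ℝ) ^ (-p) := by positivity
    calc C * (n * (n : ℝ) ^ (-p)) ≤ C * ((n + 1) * (M : ℝ) ^ (-p)) := by gcongr; linarith
      _ = _ := by ring
  have hmid : ∀ N, M ≤ N → ‖∑ n ∈ Icc 1 N, (∑ k ∈ Icc 1 n, u k) / (n * (n + 1)) -
      ∑ n ∈ Icc 1 M, (∑ k ∈ Icc 1 n, u k) / (n * (n + 1))‖ ≤
        C / p * ((M : ℝ) ^ (-p) - ((N : ℕ) + 1 : ℝ) ^ (-p)) := by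
    intro N hN
    induction N, hN using Nat.le_induction with
    | base =>
      simp only [sub_self, norm_zero]
      have : ((M : ℕ) + 1 : ℝ) ^ (-p) ≤ (M : ℝ) ^ (-p) :=
        Real.rpow_le_rpow_of_nonpos (by exact_mod_cast hM) (by linarith) (by linarith)
      exact mul_nonneg (by positivity) (by linarith)
    | succ N hN ih =>
      rw [sum_Icc_succ_top (by simp), add_sub_right_comm]
      refine (norm_add_le _ _).trans ?_
      have hN1 : 1 ≤ N + 1 := by simp
      have h := rpow_neg_div_succ_le hp hp1 hN1
      have h3 : ‖(∑ k ∈ Icc 1 (N + 1), u k) / (((N + 1 : ℕ) : ℂ) * (((N + 1 : ℕ) : ℂ) + 1))‖ ≤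
          C * (((N + 1 : ℕ) : ℝ) ^ (-p) / ((N + 1 : ℕ) + 1)) := by
        have : ‖(((N + 1 : ℕ) : ℂ) + 1)‖ = (N + 1 : ℕ) + 1 := by
          exact_mod_cast Complex.norm_natCast (N + 1 + 1)
        rw [norm_div, norm_mul, this, Complex.norm_natCast, div_le_iff₀ (by positivity)]
        refine (hu _ hN1).trans (le_of_eq ?_)
        rw [hpow _ hN1]
        field_simp
      have h4 := mul_le_mul_of_nonneg_left h hC
      have h5 : C * ((((N + 1 : ℕ) : ℝ) ^ (-p) - ((N + 1 + 1 : ℕ) : ℝ) ^ (-p)) / p) =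
        C / p * (((N + 1 : ℕ) : ℝ) ^ (-p) - (((N + 1 : ℕ) : ℝ) + 1) ^ (-p)) := by
        push_cast; ring
      push_cast at *
      linarith
  have hA := sum_div_sub_div_eq u N
  have hB := sum_div_sub_div_eq u M
  have h0 : 0 ≤ ((N : ℕ) + 1 : ℝ) ^ (-p) := by positivity
  have h1 := hmid N hMN
  rw [← hA, ← hB] at h1
  have h2 : ∑ n ∈ Icc 1 N, u n / n - ∑ n ∈ Icc 1 M, u n / n =
      (∑ n ∈ Icc 1 N, u n / n - (∑ n ∈ Icc 1 N, u n) / (N + 1) -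
        (∑ n ∈ Icc 1 M, u n / n - (∑ n ∈ Icc 1 M, u n) / (M + 1))) +
        (∑ n ∈ Icc 1 N, u n) / (N + 1) - (∑ n ∈ Icc 1 M, u n) / (M + 1) := by ring
  rw [h2]
  refine (norm_sub_le _ _).trans ?_
  refine (add_le_add_left (norm_add_le _ _) _).trans ?_
  have h3 := hend N hMN
  have h4 := hend M le_rfl
  have h5 : 0 ≤ C / p * ((N : ℕ) + 1 : ℝ) ^ (-p) := by positivity
  have h6 : C * (2 + 1 / p) * (M : ℝ) ^ (-p) = C / p * (M : ℝ) ^ (-p) + 2 * (C * (M : ℝ) ^ (-p)) := by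
    ring
  rw [h6]
  linarith [mul_sub (C / p) ((M : ℝ) ^ (-p)) (((N : ℕ) + 1 : ℝ) ^ (-p))]

lemma norm_sum_div_mul_e_sub_le (a : ℕ → ℂ) {N : ℕ} {K : ℝ}
    (hK : ∀ x : ℝ, ‖∑ n ∈ Icc 1 N, a n * e (n * x)‖ ≤ K) (x y : ℝ) :
    ‖∑ n ∈ Icc 1 N, a n / n * e (n * x) - ∑ n ∈ Icc 1 N, a n / n * e (n * y)‖ ≤
      2 * Real.pi * K * |x - y| := by
  have hd (x : ℝ) : HasDerivAt (fun x : ℝ => ∑ n ∈ Icc 1 N, a n / n * e (n * x))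
      (2 * Real.pi * Complex.I * ∑ n ∈ Icc 1 N, a n * e (n * x)) x := by
    have := HasDerivAt.fun_sum (u := Icc 1 N)
      fun n _ => (hasDerivAt_e_mul n x).const_mul (a n / n)
    refine this.congr_deriv ?_
    rw [mul_sum]
    refine sum_congr rfl fun n hn => ?_
    have : (n : ℂ) ≠ 0 := by
      rw [Finset.mem_Icc] at hn
      exact_mod_cast (by omega : n ≠ 0)
    push_cast
    field_simp
  have := Convex.norm_image_sub_le_of_norm_hasDerivWithin_le (s := Set.univ) (x := y) (y := x)
    (C := 2 * Real.pi * K) (fun x _ => (hd x).hasDerivWithinAt) (fun x _ => ?_) convex_univ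
    trivial trivial
  · simpa using this
  · rw [norm_mul]
    have : ‖(2 * Real.pi * Complex.I : ℂ)‖ = 2 * Real.pi := by
      simp [abs_of_pos Real.pi_pos]
    rw [this]
    gcongr
    exact hK x

/-- A Fourier series `∑ a n / n * e (n x)` such that the partial sums of `∑ a n * e (n x)` are
uniformly `O(N ^ (1 - β))` for all `β < 1 / 2` converges uniformly to a function that is Hölder
continuous of every index `β < 1 / 2`. -/
theorem exists_tendstoUniformly_of_partial_sums_le (a : ℕ → ℂ)
    (ha : ∀ β : ℝ, 0 < β → β < 1 / 2 → ∃ C : ℝ, ∀ N : ℕ, 1 ≤ N → ∀ x : ℝ,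
      ‖∑ n ∈ Icc 1 N, a n * e (n * x)‖ ≤ C * (N : ℝ) ^ (1 - β)) :
    ∃ φ : ℝ → ℂ,
      TendstoUniformly (fun N x => ∑ n ∈ Finset.Icc 1 N, (a n / (n : ℂ)) * e ((n : ℝ) * x))
        φ Filter.atTop ∧
      Continuous φ ∧ Function.Periodic φ 1 ∧
      ∀ β : ℝ, 0 < β → β < 1/2 → ∃ C > (0:ℝ), ∀ x y : ℝ,
        ‖φ x - φ y‖ ≤ C * |x - y| ^ β := by
  have key (β : ℝ) (h0 : 0 < β) (h1 : β < 1 / 2) : ∃ C : ℝ, 0 ≤ C ∧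
      (∀ N : ℕ, 1 ≤ N → ∀ x : ℝ, ‖∑ n ∈ Icc 1 N, a n * e (n * x)‖ ≤ C * (N : ℝ) ^ (1 - β)) ∧
      ∀ M N : ℕ, 1 ≤ M → M ≤ N → ∀ x : ℝ,
      ‖∑ n ∈ Icc 1 N, a n / n * e (n * x) - ∑ n ∈ Icc 1 M, a n / n * e (n * x)‖ ≤
        C * (2 + 1 / β) * (M : ℝ) ^ (-β) := by
    obtain ⟨C, hC⟩ := ha β h0 h1
    refine ⟨C, by simpa using (norm_nonneg _).trans (hC 1 le_rfl 0), hC, fun M N hM hMN x => ?_⟩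
    have := norm_sum_div_sub_le h0 (by linarith) (fun n => a n * e (n * x))
      (fun N hN => hC N hN x) hM hMN
    simpa only [div_mul_eq_mul_div] using this
  have hlim (β : ℝ) (h0 : 0 < β) (K : ℝ) :
      Tendsto (fun M : ℕ => K * (M : ℝ) ^ (-β)) atTop (nhds 0) := by
    simpa using ((tendsto_rpow_neg_atTop h0).comp tendsto_natCast_atTop_atTop).const_mul K
  have hconv (x : ℝ) : ∃ l, Tendsto (fun N => ∑ n ∈ Icc 1 N, a n / n * e (n * x)) atTop (nhds l) := by
    obtain ⟨C, -, -, hC⟩ := key (1 / 4) (by norm_num) (by norm_num)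
    refine cauchySeq_tendsto_of_complete (cauchySeq_of_le_tendsto_0'
      (fun M : ℕ => if 1 ≤ M then C * (2 + 1 / (1 / 4)) * (M : ℝ) ^ (-(1 / 4) : ℝ) else
        ‖∑ n ∈ Icc 1 1, a n / n * e (n * x)‖ + C * (2 + 1 / (1 / 4)) * ((1 : ℕ) : ℝ) ^ (-(1 / 4) : ℝ))
      (fun M N hMN => ?_) ?_)
    · rw [dist_comm, dist_eq_norm]
      split_ifs with h
      · exact hC M N h hMN x
      · obtain rfl : M = 0 := by omega
        rcases Nat.eq_zero_or_pos N with rfl | hN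
        · have := (norm_nonneg _).trans (hC 1 1 le_rfl le_rfl x)
          simp only [sub_self, norm_zero]
          positivity
        · have := hC 1 N le_rfl hN x
          have h2 := norm_add_le (∑ n ∈ Icc 1 1, a n / n * e (n * x))
            (∑ n ∈ Icc 1 N, a n / n * e (n * x) - ∑ n ∈ Icc 1 1, a n / n * e (n * x))
          simp only [add_sub_cancel] at h2
          simp only [show Icc 1 0 = (∅ : Finset ℕ) from rfl, sum_empty, sub_zero]
          linarith
    · refine (hlim (1 / 4) (by norm_num) (C * (2 + 1 / (1 / 4)))).congr' ?_
      filter_upwards [eventually_ge_atTop 1] with M hM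
      rw [if_pos hM]
  choose φ hφ using hconv
  have hφ_le (β : ℝ) (h0 : 0 < β) (C : ℝ) (hC : ∀ M N : ℕ, 1 ≤ M → M ≤ N → ∀ x : ℝ,
      ‖∑ n ∈ Icc 1 N, a n / n * e (n * x) - ∑ n ∈ Icc 1 M, a n / n * e (n * x)‖ ≤
        C * (M : ℝ) ^ (-β)) (M : ℕ) (hM : 1 ≤ M) (x : ℝ) :
      ‖φ x - ∑ n ∈ Icc 1 M, a n / n * e (n * x)‖ ≤ C * (M : ℝ) ^ (-β) := by
    refine le_of_tendsto ((hφ x).sub_const _).norm ?_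
    filter_upwards [eventually_ge_atTop M] with N hN using hC M N hM hN x
  have hunif : TendstoUniformly
      (fun N x => ∑ n ∈ Finset.Icc 1 N, (a n / (n : ℂ)) * e ((n : ℝ) * x)) φ atTop := by
    obtain ⟨C, -, -, hC⟩ := key (1 / 4) (by norm_num) (by norm_num)
    rw [Metric.tendstoUniformly_iff]
    intro ε hε
    filter_upwards [(hlim (1 / 4) (by norm_num) (C * (2 + 1 / (1 / 4)))).eventually_lt_const hε,
      eventually_ge_atTop 1] with N hN hN1 x
    rw [dist_eq_norm]
    exact (hφ_le _ (by norm_num) _ hC N hN1 x).trans_lt hN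
  refine ⟨φ, hunif, ?_, ?_, ?_⟩
  · refine hunif.continuous (Frequently.of_forall fun N => ?_)
    have := continuous_e
    fun_prop
  · intro x
    refine tendsto_nhds_unique (hφ (x + 1)) ?_
    convert hφ x using 4
    rw [mul_add, e_add, mul_one, e_natCast, mul_one]
  · intro β h0 h1
    obtain ⟨C, hC0, hS, hC⟩ := key β h0 h1
    set B := C * (2 + 1 / β) with hB
    have hB0 : 0 ≤ B := by positivity
    have hl := hφ_le β h0 B hC
    refine ⟨4 * Real.pi * C + 2 * B + 2 * C + 1, by positivity, fun x y => ?_⟩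
    have hπ := Real.pi_pos
    rcases eq_or_ne x y with rfl | hxy
    · simp only [sub_self, norm_zero]
      positivity
    have hh : 0 < |x - y| := abs_pos.mpr (sub_ne_zero.mpr hxy)
    set h := |x - y| with hdef
    rcases le_or_gt h 1 with hle | hgt
    · set N := ⌈1 / h⌉₊ with hN
      have hN1 : 1 ≤ N := Nat.one_le_iff_ne_zero.mpr (Nat.ceil_pos.mpr (by positivity)).ne'
      have hNge : 1 / h ≤ N := Nat.le_ceil _
      have hNle : (N : ℝ) ≤ 2 / h := by
        have := (Nat.ceil_lt_add_one (by positivity : 0 ≤ 1 / h)).le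
        have h3 : 1 ≤ 1 / h := by rw [le_div_iff₀ hh]; linarith
        calc (N : ℝ) ≤ 1 / h + 1 := this
          _ ≤ 1 / h + 1 / h := by linarith
          _ = 2 / h := by ring
      have hN0 : (0 : ℝ) < N := by exact_mod_cast hN1
      have hNβ : (N : ℝ) ^ (-β) ≤ h ^ β := by
        have := Real.rpow_le_rpow_of_nonpos (z := -β) (by positivity) hNge (by linarith)
        rwa [one_div, Real.inv_rpow hh.le, Real.rpow_neg hh.le, inv_inv] at this
      have hmid := norm_sum_div_mul_e_sub_le a (hS N hN1) x y
      have hmid2 : (N : ℝ) ^ (1 - β) * h ≤ 2 * h ^ β := by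
        rw [sub_eq_add_neg, Real.rpow_add hN0, Real.rpow_one]
        calc (N : ℝ) * (N : ℝ) ^ (-β) * h ≤ (2 / h) * h ^ β * h := by gcongr
          _ = _ := by field_simp
      have hx := (hl N hN1 x).trans (mul_le_mul_of_nonneg_left hNβ hB0)
      have hy := (hl N hN1 y).trans (mul_le_mul_of_nonneg_left hNβ hB0)
      have htri := norm_sub_le_norm_sub_add_norm_sub (φ x)
        (∑ n ∈ Icc 1 N, a n / n * e (n * x)) (φ y)
      have htri2 := norm_sub_le_norm_sub_add_norm_sub (∑ n ∈ Icc 1 N, a n / n * e (n * x))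
        (∑ n ∈ Icc 1 N, a n / n * e (n * y)) (φ y)
      rw [norm_sub_rev (φ y)] at hy
      have h5 : 2 * Real.pi * (C * (N : ℝ) ^ (1 - β)) * h ≤ 2 * Real.pi * C * (2 * h ^ β) := by
        calc _ = 2 * Real.pi * C * ((N : ℝ) ^ (1 - β) * h) := by ring
          _ ≤ _ := by gcongr
      have h6 : 0 ≤ h ^ β := by positivity
      have h7 : 0 ≤ C * h ^ β := by positivity
      rw [← hdef] at hmid
      linarith
    · have hb (x : ℝ) : ‖φ x‖ ≤ C + B := by
        have h1 := hl 1 le_rfl x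
        have h2 := hS 1 le_rfl x
        simp only [Icc_self, sum_singleton, Nat.cast_one, div_one, Real.one_rpow, mul_one] at h1 h2
        have h3 := norm_add_le (φ x - a 1 * e (1 * x)) (a 1 * e (1 * x))
        rw [sub_add_cancel] at h3
        linarith
      have h6 : 1 ≤ h ^ β := Real.one_le_rpow hgt.le h0.le
      have := norm_sub_le (φ x) (φ y)
      have h7 := hb x
      have h8 := hb y
      have : 4 * Real.pi * C + 2 * B + 2 * C + 1 ≤ (4 * Real.pi * C + 2 * B + 2 * C + 1) * h ^ β :=
        le_mul_of_one_le_right (by positivity) h6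
      have : 0 ≤ 4 * Real.pi * C := by positivity
      linarith
lemma e_neg_natCast_mul (n : ℕ) (t : ℝ) : e (-(n * t)) = e (-t) ^ n := by
  rw [e, e, ← Complex.exp_nat_mul]; push_cast; ring_nf

lemma integral_e_int_mul (k : ℤ) : ∫ t in (0 : ℝ)..1, e (k * t) = if k = 0 then 1 else 0 := by
  split_ifs with hk
  · simp [hk, e]
  · have h : (2 * Real.pi * Complex.I * k : ℂ) ≠ 0 := by simp [hk, Real.pi_ne_zero]
    have h1 : ∀ t : ℝ, e (k * t) = Complex.exp (2 * Real.pi * Complex.I * k * t) := fun t => by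
      rw [e]; push_cast; ring_nf
    simp_rw [h1]
    rw [integral_exp_mul_complex h]
    have : Complex.exp (2 * Real.pi * Complex.I * k) = 1 := by
      rw [Complex.exp_eq_one_iff]; exact ⟨k, by ring⟩
    simp [this]

lemma continuous_tsum_mul_e {b : ℕ → ℂ} (hb : Summable fun n => ‖b n‖) :
    Continuous fun t : ℝ => ∑' n, b n * e (n * t) := by
  have := continuous_e
  exact continuous_tsum (fun n => by fun_prop) hb fun n t => by rw [norm_mul, norm_e, mul_one]

/-- Fourier coefficients of an absolutely convergent Fourier series. -/
lemma integral_tsum_mul_e {b : ℕ → ℂ} (hb : Summable fun n => ‖b n‖) (m : ℕ) :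
    ∫ t in (0 : ℝ)..1, (∑' n, b n * e (n * t)) * e (-(m * t)) = b m := by
  have hc := continuous_e
  let f : ℕ → C(ℝ, ℂ) := fun n => ⟨fun t => b n * e (((n : ℤ) - (m : ℤ) : ℤ) * t), by fun_prop⟩
  have hs : Summable fun n => ‖(f n).restrict
      (⟨Set.uIcc (0 : ℝ) 1, isCompact_uIcc⟩ : TopologicalSpace.Compacts ℝ)‖ := by
    refine Summable.of_nonneg_of_le (fun n => norm_nonneg _) (fun n => ?_) hb
    rw [ContinuousMap.norm_le _ (norm_nonneg _)]
    intro t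
    simp [f, norm_e]
  have h := intervalIntegral.hasSum_intervalIntegral_of_summable_norm hs
  have h2 : HasSum (fun n => ∫ t in (0 : ℝ)..1, f n t) (b m) := by
    have : (fun n => ∫ t in (0 : ℝ)..1, f n t) = fun n => if n = m then b m else 0 := by
      ext n
      simp only [f, ContinuousMap.coe_mk, intervalIntegral.integral_const_mul, integral_e_int_mul,
        sub_eq_zero, Nat.cast_inj]
      split_ifs with h
      · rw [h, mul_one]
      · simp
    rw [this]
    exact hasSum_ite_eq m (b m)
  rw [← h.unique h2]
  refine intervalIntegral.integral_congr fun t _ => ?_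
  simp only [← tsum_mul_right, f, ContinuousMap.coe_mk]
  refine tsum_congr fun n => ?_
  rw [mul_assoc, ← e_add]
  push_cast
  ring_nf

lemma norm_sub_one_le_norm_mul_sub_one {u : ℂ} (hu : ‖u‖ = 1) {r : ℝ} (hr : 1 ≤ r) :
    ‖u - 1‖ ≤ ‖r * u - 1‖ := by
  have h1 : u.re ^ 2 + u.im ^ 2 = 1 := by
    have := Complex.sq_norm u
    rw [hu, Complex.normSq_apply] at this
    linarith
  have h2 : u.re ≤ 1 := by nlinarith [sq_nonneg u.im]
  rw [← sq_le_sq₀ (norm_nonneg _) (norm_nonneg _), Complex.sq_norm, Complex.sq_norm,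
    Complex.normSq_apply, Complex.normSq_apply]
  simp
  nlinarith [mul_nonneg (sub_nonneg.mpr hr) (sub_nonneg.mpr h2), sq_nonneg (r - 1)]

lemma min_le_norm_e_neg_sub_one {t : ℝ} (h0 : 0 ≤ t) (h1 : t ≤ 1) :
    min t (1 - t) ≤ ‖e (-t) - 1‖ := by
  have hπ := Real.pi_pos
  have h2 : ‖e (-t) - 1‖ = ‖2 * Real.sin (Real.pi * t)‖ := by
    have : e (-t) = Complex.exp (Complex.I * ((2 * Real.pi * (-t) : ℝ) : ℂ)) := by
      rw [e]; push_cast; ring_nf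
    rw [this, Complex.norm_exp_I_mul_ofReal_sub_one]
    have : 2 * Real.pi * -t / 2 = -(Real.pi * t) := by ring
    rw [this, Real.sin_neg, mul_neg, norm_neg]
  have h3 : 2 * min t (1 - t) ≤ Real.sin (Real.pi * t) := by
    rcases le_total t (1 / 2) with h | h
    · have := Real.mul_le_sin (x := Real.pi * t) (by positivity) (by nlinarith)
      have h4 : 2 / Real.pi * (Real.pi * t) = 2 * t := by field_simp
      linarith [min_le_left t (1 - t)]
    · have := Real.mul_le_sin (x := Real.pi - Real.pi * t) (by nlinarith) (by nlinarith)
      have h4 : 2 / Real.pi * (Real.pi - Real.pi * t) = 2 * (1 - t) := by field_simp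
      rw [Real.sin_pi_sub] at this
      linarith [min_le_right t (1 - t)]
  have h5 : 0 ≤ min t (1 - t) := le_min h0 (by linarith)
  rw [h2, Real.norm_eq_abs]
  refine le_trans ?_ (le_abs_self _)
  linarith

/-- The Dirichlet-type kernel that extracts the first `N` coefficients of a power series on the
circle of radius `exp (-2π / N)`. -/
noncomputable def dirichletKernel (N : ℕ) (t : ℝ) : ℂ :=
  ∑ m ∈ Icc 1 N, (Real.exp (2 * Real.pi * m / N) : ℂ) * e (-(m * t))

lemma dirichletKernel_eq_sum_pow (N : ℕ) (t : ℝ) : dirichletKernel N t =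
    ∑ m ∈ Icc 1 N, ((Real.exp (2 * Real.pi / N) : ℂ) * e (-t)) ^ m := by
  refine sum_congr rfl fun m _ => ?_
  rw [mul_pow, e_neg_natCast_mul, ← Complex.ofReal_pow, ← Real.exp_nat_mul]
  ring_nf

lemma norm_exp_mul_e_pow_le {N m k : ℕ} (hN : 1 ≤ N) (hm : m ≤ k * N) (t : ℝ) :
    ‖((Real.exp (2 * Real.pi / N) : ℂ) * e (-t)) ^ m‖ ≤ Real.exp (2 * Real.pi * k) := by
  have hN0 : (0 : ℝ) < N := by exact_mod_cast hN
  rw [norm_pow, norm_mul, norm_e, mul_one, Complex.norm_real, Real.norm_of_nonneg (Real.exp_nonneg _),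
    ← Real.exp_nat_mul]
  refine Real.exp_le_exp.mpr ?_
  rw [mul_div_assoc', div_le_iff₀ hN0]
  have : (m : ℝ) ≤ k * N := by exact_mod_cast hm
  nlinarith [Real.pi_pos]

lemma norm_dirichletKernel_le {N : ℕ} (hN : 1 ≤ N) (t : ℝ) :
    ‖dirichletKernel N t‖ ≤ 2 * Real.exp (4 * Real.pi) * N := by
  rw [dirichletKernel_eq_sum_pow]
  refine (norm_sum_le _ _).trans ?_
  refine (sum_le_card_nsmul _ _ (Real.exp (2 * Real.pi * (1 : ℕ))) fun m hm =>
    norm_exp_mul_e_pow_le hN ?_ t).trans ?_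
  · rw [Finset.mem_Icc] at hm; omega
  · have : Real.exp (2 * Real.pi * (1 : ℕ)) ≤ Real.exp (4 * Real.pi) :=
      Real.exp_le_exp.mpr (by push_cast; linarith [Real.pi_pos])
    have h2 := Real.exp_pos (4 * Real.pi)
    rw [Nat.card_Icc, Nat.add_sub_cancel, nsmul_eq_mul, mul_comm]
    gcongr
    linarith

lemma norm_dirichletKernel_mul_le {N : ℕ} (hN : 1 ≤ N) {t : ℝ} (h0 : 0 ≤ t) (h1 : t ≤ 1) :
    ‖dirichletKernel N t‖ * min t (1 - t) ≤ 2 * Real.exp (4 * Real.pi) := by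
  have hN0 : (0 : ℝ) < N := by exact_mod_cast hN
  set w : ℂ := (Real.exp (2 * Real.pi / N) : ℂ) * e (-t) with hw
  have hmin : min t (1 - t) ≤ ‖w - 1‖ :=
    (min_le_norm_e_neg_sub_one h0 h1).trans (norm_sub_one_le_norm_mul_sub_one (norm_e _)
      (Real.one_le_exp (by have := Real.pi_pos; positivity)))
  have hgeom : dirichletKernel N t * (w - 1) = w ^ (N + 1) - w ^ 1 := by
    rw [dirichletKernel_eq_sum_pow, ← hw]
    have := geom_sum_Ico_mul w (show 1 ≤ N + 1 by omega)
    rwa [Finset.Ico_add_one_right_eq_Icc] at this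
  calc ‖dirichletKernel N t‖ * min t (1 - t) ≤ ‖dirichletKernel N t‖ * ‖w - 1‖ := by gcongr
    _ = ‖w ^ (N + 1) - w ^ 1‖ := by rw [← norm_mul, hgeom]
    _ ≤ ‖w ^ (N + 1)‖ + ‖w ^ 1‖ := norm_sub_le _ _
    _ ≤ Real.exp (2 * Real.pi * (2 : ℕ)) + Real.exp (2 * Real.pi * (2 : ℕ)) :=
        add_le_add (norm_exp_mul_e_pow_le hN (by omega) t) (norm_exp_mul_e_pow_le hN (by omega) t)
    _ = 2 * Real.exp (4 * Real.pi) := by push_cast; ring_nf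

lemma norm_dirichletKernel_le_rpow {δ : ℝ} (hδ : 0 < δ) (hδ1 : δ < 1) {N : ℕ} (hN : 1 ≤ N) {t : ℝ}
    (h0 : 0 < t) (h1 : t < 1) : ‖dirichletKernel N t‖ ≤
      2 * Real.exp (4 * Real.pi) * (N : ℝ) ^ δ * (t ^ (δ - 1) + (1 - t) ^ (δ - 1)) := by
  have hN0 : (0 : ℝ) < N := by exact_mod_cast hN
  set A := 2 * Real.exp (4 * Real.pi) with hA
  have hA0 : 0 < A := by positivity
  have hm : 0 < min t (1 - t) := lt_min h0 (by linarith)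
  set k := ‖dirichletKernel N t‖ with hk
  have hk0 : 0 ≤ k := norm_nonneg _
  have hk1 : k ≤ A * N := norm_dirichletKernel_le hN t
  have hk2 : k ≤ A / min t (1 - t) := by
    rw [le_div_iff₀ hm]; exact norm_dirichletKernel_mul_le hN h0.le h1.le
  have hmin : (min t (1 - t)) ^ (δ - 1) ≤ t ^ (δ - 1) + (1 - t) ^ (δ - 1) := by
    have h2 : 0 ≤ t ^ (δ - 1) := by positivity
    have h3 : 0 ≤ (1 - t) ^ (δ - 1) := Real.rpow_nonneg (by linarith) _
    rcases min_choice t (1 - t) with h | h <;> rw [h] <;> linarith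
  calc k = k ^ δ * k ^ (1 - δ) := by
        rw [← Real.rpow_add' hk0 (by simp), add_sub_cancel, Real.rpow_one]
    _ ≤ (A * N) ^ δ * (A / min t (1 - t)) ^ (1 - δ) :=
        mul_le_mul (Real.rpow_le_rpow hk0 hk1 hδ.le) (Real.rpow_le_rpow hk0 hk2 (by linarith))
          (by positivity) (by positivity)
    _ = A * (N : ℝ) ^ δ * (min t (1 - t)) ^ (δ - 1) := by
        rw [Real.mul_rpow hA0.le hN0.le, Real.div_rpow hA0.le hm.le, div_eq_mul_inv,
          ← Real.rpow_neg hm.le, neg_sub]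
        have : A ^ δ * A ^ (1 - δ) = A := by
          rw [← Real.rpow_add hA0, add_sub_cancel, Real.rpow_one]
        linear_combination (N : ℝ) ^ δ * (min t (1 - t)) ^ (δ - 1) * this
    _ ≤ _ := by gcongr

/-- If `∑ a n * exp (2 π i n z)` is `O((im z) ^ (-1/2))` on the upper half-plane, the partial sums
of `∑ a n * e (n x)` are uniformly `O(N ^ (1 / 2 + δ))` for every `δ > 0`. -/
theorem norm_partial_sum_le {a : ℕ → ℂ} {C : ℝ}
    (hs : ∀ y : ℝ, 0 < y → Summable fun n : ℕ => ‖a n‖ * Real.exp (-(2 * Real.pi * n * y)))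
    (hC : ∀ y : ℝ, 0 < y → ∀ x : ℝ,
      ‖∑' n : ℕ, a n * (Real.exp (-(2 * Real.pi * n * y)) : ℂ) * e (n * x)‖ ≤
        C * y ^ (-(1 / 2) : ℝ))
    {δ : ℝ} (hδ : 0 < δ) (hδ1 : δ < 1) :
    ∃ K : ℝ, ∀ N : ℕ, 1 ≤ N → ∀ x : ℝ,
      ‖∑ n ∈ Icc 1 N, a n * e (n * x)‖ ≤ K * (N : ℝ) ^ (1 / 2 + δ) := by
  have hce := continuous_e
  refine ⟨C * (2 * Real.exp (4 * Real.pi)) *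
    ∫ t in (0 : ℝ)..1, (t ^ (δ - 1) + (1 - t) ^ (δ - 1)), fun N hN x => ?_⟩
  have hN0 : (0 : ℝ) < N := by exact_mod_cast hN
  have hy : (0 : ℝ) < 1 / N := by positivity
  set b : ℕ → ℂ := fun n =>
    a n * (Real.exp (-(2 * Real.pi * n * (1 / N))) : ℂ) * e (n * x) with hb
  have hbs : Summable fun n => ‖b n‖ := by
    refine (hs _ hy).congr fun n => ?_
    rw [hb, norm_mul, norm_mul, norm_e, mul_one, Complex.norm_real,
      Real.norm_of_nonneg (Real.exp_nonneg _)]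
  have hΦ := continuous_tsum_mul_e hbs
  have hΦle (t : ℝ) : ‖∑' n, b n * e (n * t)‖ ≤ C * (N : ℝ) ^ (1 / 2 : ℝ) := by
    have := hC _ hy (x + t)
    rw [one_div, Real.inv_rpow hN0.le, Real.rpow_neg hN0.le, inv_inv, ← one_div] at this
    simpa only [mul_add, e_add, mul_assoc, hb] using this
  have hrepr : ∑ n ∈ Icc 1 N, a n * e (n * x) =
      ∫ t in (0 : ℝ)..1, (∑' n, b n * e (n * t)) * dirichletKernel N t := by
    simp_rw [dirichletKernel, mul_sum]
    rw [intervalIntegral.integral_finsetSum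
      fun m _ => Continuous.intervalIntegrable (by fun_prop) _ _]
    refine sum_congr rfl fun m _ => ?_
    simp_rw [mul_left_comm _ (Complex.ofReal _)]
    rw [intervalIntegral.integral_const_mul, integral_tsum_mul_e hbs, hb]
    have : (Real.exp (2 * Real.pi * m / N) : ℂ) *
        (Real.exp (-(2 * Real.pi * m * (1 / N))) : ℂ) = 1 := by
      rw [← Complex.ofReal_mul, ← Real.exp_add]
      have : 2 * Real.pi * m / N + -(2 * Real.pi * m * (1 / N)) = 0 := by ring
      rw [this, Real.exp_zero, Complex.ofReal_one]
    linear_combination -(a m * e (m * x)) * this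
  have hint1 : IntervalIntegrable (fun t : ℝ => t ^ (δ - 1)) MeasureTheory.volume 0 1 :=
    intervalIntegral.intervalIntegrable_rpow' (by linarith)
  have hint2 : IntervalIntegrable (fun t : ℝ => (1 - t) ^ (δ - 1)) MeasureTheory.volume 0 1 := by
    simpa using (hint1.comp_sub_left 1).symm
  have hC0 : 0 ≤ C := by simpa using (norm_nonneg _).trans (hC 1 one_pos 0)
  rw [hrepr]
  refine (intervalIntegral.norm_integral_le_of_norm_le zero_le_one
    (g := fun t => C * (2 * Real.exp (4 * Real.pi)) * (N : ℝ) ^ (1 / 2 + δ) *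
      (t ^ (δ - 1) + (1 - t) ^ (δ - 1))) ?_ ((hint1.add hint2).const_mul _)).trans ?_
  · have : ∀ᵐ t : ℝ, t ≠ 1 := by simp [MeasureTheory.ae_iff]
    filter_upwards [this] with t ht1 ht
    have hk := norm_dirichletKernel_le_rpow hδ hδ1 hN ht.1 (lt_of_le_of_ne ht.2 ht1)
    rw [norm_mul, Real.rpow_add hN0]
    calc _ ≤ (C * (N : ℝ) ^ (1 / 2 : ℝ)) * _ :=
          mul_le_mul (hΦle t) hk (norm_nonneg _) (by positivity)
      _ = _ := by ring
  · rw [intervalIntegral.integral_const_mul]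
    exact le_of_eq (by ring)

lemma norm_prod_one_sub_pow_le {x : ℂ} (hx : ‖x‖ < 1) (k n : ℕ) :
    ‖∏ i ∈ range (n + 1), (1 - x ^ (k + i + 1))‖ ≤ Real.exp (1 - ‖x‖)⁻¹ := by
  rw [norm_prod]
  have hs := summable_geometric_of_lt_one (norm_nonneg x) hx
  calc ∏ i ∈ range (n + 1), ‖1 - x ^ (k + i + 1)‖
      ≤ ∏ i ∈ range (n + 1), Real.exp (‖x‖ ^ i) := by
        refine prod_le_prod (fun _ _ => norm_nonneg _) fun i _ => ?_
        calc ‖1 - x ^ (k + i + 1)‖ ≤ 1 + ‖x‖ ^ (k + i + 1) := by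
              simpa using norm_sub_le (1 : ℂ) (x ^ (k + i + 1))
          _ ≤ ‖x‖ ^ i + 1 := by
              have := pow_le_pow_of_le_one (norm_nonneg x) hx.le (show i ≤ k + i + 1 by omega)
              linarith
          _ ≤ _ := Real.add_one_le_exp _
    _ = Real.exp (∑ i ∈ range (n + 1), ‖x‖ ^ i) := (Real.exp_sum _ _).symm
    _ ≤ Real.exp (1 - ‖x‖)⁻¹ := by
        rw [← tsum_geometric_of_lt_one (norm_nonneg x) hx]
        gcongr
        exact hs.sum_le_tsum _ fun _ _ => by positivity

lemma norm_pow_mul_prod_one_sub_pow_le {x : ℂ} (hx : ‖x‖ < 1) (k n : ℕ) :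
    ‖x ^ ((k + 1) * n) * ∏ i ∈ range (n + 1), (1 - x ^ (k + i + 1))‖ ≤
      ‖x‖ ^ n * Real.exp (1 - ‖x‖)⁻¹ := by
  rw [norm_mul, norm_pow]
  exact mul_le_mul (pow_le_pow_of_le_one (norm_nonneg x) hx.le (by nlinarith))
    (norm_prod_one_sub_pow_le hx k n) (norm_nonneg _) (by positivity)

lemma summable_neg_one_zpow_mul_pow_pentagonal {x : ℂ} (hx : ‖x‖ < 1) :
    Summable fun k : ℤ => ‖(-1 : ℂ) ^ k * x ^ pentagonal k‖ := by
  simpa [Function.comp_def] using (summable_geometric_of_lt_one (norm_nonneg x) hx).comp_injective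
    pentagonal_injective

/-- **Pentagonal number theorem** in the open unit disc. -/
theorem hasSum_neg_one_zpow_mul_pow_pentagonal {x : ℂ} (hx : ‖x‖ < 1) :
    HasSum (fun k : ℤ => (-1 : ℂ) ^ k * x ^ pentagonal k) (∏' n : ℕ, (1 - x ^ (n + 1))) := by
  have hs : Summable fun k : ℤ => (-1 : ℂ) ^ k * x ^ pentagonal k :=
    (summable_neg_one_zpow_mul_pow_pentagonal hx).of_norm
  have hneg : ∀ k : ℤ, (-1 : ℂ) ^ (-k) = (-1) ^ k := fun k => by
    rw [zpow_neg, ← inv_zpow, inv_neg, inv_one]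
  have hs' : Summable fun k : ℤ => (-1 : ℂ) ^ k * x ^ pentagonal (-k) := by
    simpa [Function.comp_def, hneg] using (Equiv.neg ℤ).summable_iff.mpr hs
  have h1 : Summable fun k : ℕ => (-1 : ℂ) ^ (k : ℤ) * x ^ pentagonal (-k) :=
    hs'.comp_injective Nat.cast_injective
  have h2 : Summable fun k : ℕ => (-1 : ℂ) ^ (-((k : ℤ) + 1)) * x ^ pentagonal (-(-((k : ℤ) + 1))) :=
    hs'.comp_injective (i := fun k : ℕ => -((k : ℤ) + 1)) fun a b h => by simpa using h
  have h3 : ∀ k : ℕ, (-1 : ℂ) ^ (k : ℤ) * x ^ pentagonal (-k) +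
      (-1 : ℂ) ^ (-((k : ℤ) + 1)) * x ^ pentagonal (-(-((k : ℤ) + 1))) =
      (-1) ^ k * (x ^ pentagonal (-k) - x ^ pentagonal (k + 1)) := fun k => by
    rw [hneg, neg_neg, zpow_add_one₀ (by norm_num), zpow_natCast]
    ring
  have hM : Summable fun n : ℕ => ‖x‖ ^ n * Real.exp (1 - ‖x‖)⁻¹ :=
    (summable_geometric_of_lt_one (norm_nonneg x) hx).mul_right _
  have key : ∏' n : ℕ, (1 - x ^ (n + 1)) =
      ∑' k : ℕ, (-1) ^ k * (x ^ pentagonal (-k) - x ^ pentagonal (k + 1)) := by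
    refine Pentagonal.tprod_one_sub_pow (tendsto_pow_atTop_nhds_zero_of_norm_lt_one hx)
      (fun k => hM.of_norm_bounded (norm_pow_mul_prod_one_sub_pow_le hx k)) (fun k => ?_)
      (by simpa only [h3] using h1.add h2) ?_
    · simp only [sub_eq_add_neg]
      refine multipliable_one_add_of_summable ?_
      simpa [add_assoc] using (summable_nat_add_iff (k + 1)).mpr
        (summable_geometric_of_lt_one (norm_nonneg x) hx)
    · refine squeeze_zero_norm (a := fun k : ℕ => ‖x‖ ^ k *
        ∑' n : ℕ, ‖x‖ ^ n * Real.exp (1 - ‖x‖)⁻¹) (fun k => ?_) ?_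
      · rw [norm_mul, norm_mul, norm_pow, norm_neg, norm_one, one_pow, one_mul, norm_pow]
        have hk : k ≤ (k + 1) * (3 * k + 4) / 2 := by
          rw [Nat.le_div_iff_mul_le two_pos]
          nlinarith
        have hb := tsum_of_norm_bounded hM.hasSum (norm_pow_mul_prod_one_sub_pow_le hx k)
        generalize (k + 1) * (3 * k + 4) / 2 = j at hk
        exact mul_le_mul (pow_le_pow_of_le_one (norm_nonneg x) hx.le hk) hb
          (norm_nonneg _) (by positivity)
      · simpa using (tendsto_pow_atTop_nhds_zero_of_lt_one (norm_nonneg x) hx).mul_const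
          (∑' n : ℕ, ‖x‖ ^ n * Real.exp (1 - ‖x‖)⁻¹)
  have h4 : HasSum (fun k : ℤ => (-1 : ℂ) ^ k * x ^ pentagonal (-k))
      (∏' n : ℕ, (1 - x ^ (n + 1))) := by
    have := HasSum.of_nat_of_neg_add_one
      (f := fun k : ℤ => (-1 : ℂ) ^ k * x ^ pentagonal (-k)) h1.hasSum h2.hasSum
    rwa [← h1.tsum_add h2, tsum_congr h3, ← key] at this
  simpa [Function.comp_def, hneg] using (Equiv.neg ℤ).hasSum_iff.mpr h4

lemma tsum_eq_sum_tsum_residues (n : ℕ) [NeZero n] {G : ℤ × ℤ → ℂ} (hG : Summable G) :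
    ∑' p, G p = ∑ r : Fin n, ∑' p : ℤ × ℤ, G (n * p.1 + r, p.2) := by
  let σ : Fin n × (ℤ × ℤ) ≃ ℤ × ℤ :=
    { toFun := fun x => (n * x.2.1 + x.1, x.2.2)
      invFun := fun p => (((Int.divModEquiv n) p.1).2, ((Int.divModEquiv n) p.1).1, p.2)
      left_inv := fun x => by
        have h := (Int.divModEquiv n).right_inv (x.2.1, x.1)
        have h' : (Int.divModEquiv n).invFun (x.2.1, x.1) = n * x.2.1 + x.1 := by
          simp [Int.divModEquiv, mul_comm]
        rw [h'] at h
        have h'' : (Int.divModEquiv n) (n * x.2.1 + x.1) = (x.2.1, x.1) := h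
        simp only [h'']
      right_inv := fun p => by
        have h := (Int.divModEquiv n).left_inv p.1
        refine Prod.ext ?_ rfl
        conv_rhs => rw [← h]
        simp [Int.divModEquiv, mul_comm] }
  rw [← σ.tsum_eq G]
  change ∑' x, (G ∘ σ) x = _
  rw [Summable.tsum_prod (σ.summable_iff.mpr hG), tsum_fintype]
  rfl

lemma sum_tsum_sub_eq_two_mul (E : ℤ → ℂ)
    (hf : Summable fun p : ℤ × ℤ => E (p.1 ^ 2 + p.1 * p.2 + 6 * p.2 ^ 2))
    (hg : Summable fun p : ℤ × ℤ => E (2 * p.1 ^ 2 - 5 * p.1 * p.2 + 6 * p.2 ^ 2)) :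
    (∑' p : ℤ × ℤ, E (p.1 ^ 2 + p.1 * p.2 + 6 * p.2 ^ 2)) -
      ∑' p : ℤ × ℤ, E (2 * p.1 ^ 2 - 5 * p.1 * p.2 + 6 * p.2 ^ 2) =
    2 * ((∑' p : ℤ × ℤ, E ((6 * p.2 - 1) ^ 2 + (6 * p.2 - 1) * p.1 + 6 * p.1 ^ 2)) -
      ∑' p : ℤ × ℤ, E (2 * (6 * p.2 - 1) ^ 2 - 5 * (6 * p.2 - 1) * p.1 + 6 * p.1 ^ 2)) := by
  rw [tsum_eq_sum_tsum_residues 6 hf, tsum_eq_sum_tsum_residues 6 hg]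
  simp only [Fin.sum_univ_six]
  have shear : ∀ r : ℤ, (∑' p : ℤ × ℤ, E ((6 * p.1 + 2 * r) ^ 2 + (6 * p.1 + 2 * r) * p.2 +
      6 * p.2 ^ 2)) = ∑' p : ℤ × ℤ, E (2 * (6 * p.1 + 2 * r) ^ 2 -
        5 * (6 * p.1 + 2 * r) * p.2 + 6 * p.2 ^ 2) := fun r => by
    let σ : ℤ × ℤ ≃ ℤ × ℤ :=
      { toFun := fun p => (p.1, p.2 + (3 * p.1 + r))
        invFun := fun p => (p.1, p.2 - (3 * p.1 + r))
        left_inv := fun p => by simp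
        right_inv := fun p => by simp }
    symm
    rw [← σ.tsum_eq]
    refine tsum_congr fun p => congrArg E ?_
    simp only [σ, Equiv.coe_fn_mk]
    ring
  have reflect : (∑' p : ℤ × ℤ, E ((6 * p.1 + 3) ^ 2 + (6 * p.1 + 3) * p.2 +
      6 * p.2 ^ 2)) = ∑' p : ℤ × ℤ, E (2 * (6 * p.1 + 3) ^ 2 -
        5 * (6 * p.1 + 3) * p.2 + 6 * p.2 ^ 2) := by
    let σ : ℤ × ℤ ≃ ℤ × ℤ :=
      { toFun := fun p => (p.1, 2 * p.1 + 1 - p.2)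
        invFun := fun p => (p.1, 2 * p.1 + 1 - p.2)
        left_inv := fun p => by simp
        right_inv := fun p => by simp }
    symm
    rw [← σ.tsum_eq]
    refine tsum_congr fun p => congrArg E ?_
    simp only [σ, Equiv.coe_fn_mk]
    ring
  let τ : ℤ × ℤ ≃ ℤ × ℤ :=
    { toFun := fun p => (-p.2, -p.1)
      invFun := fun p => (-p.2, -p.1)
      left_inv := fun p => by simp
      right_inv := fun p => by simp }
  let ρ : ℤ × ℤ ≃ ℤ × ℤ :=
    { toFun := fun p => (p.2 - 1, p.1)
      invFun := fun p => (p.2, p.1 + 1)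
      left_inv := fun p => by simp
      right_inv := fun p => by simp }
  have f1 : (∑' p : ℤ × ℤ, E ((6 * p.1 + 1) ^ 2 + (6 * p.1 + 1) * p.2 + 6 * p.2 ^ 2)) =
      ∑' p : ℤ × ℤ, E ((6 * p.2 - 1) ^ 2 + (6 * p.2 - 1) * p.1 + 6 * p.1 ^ 2) := by
    rw [← τ.tsum_eq]
    refine tsum_congr fun p => congrArg E ?_
    simp only [τ, Equiv.coe_fn_mk]
    ring
  have g1 : (∑' p : ℤ × ℤ, E (2 * (6 * p.1 + 1) ^ 2 - 5 * (6 * p.1 + 1) * p.2 +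
      6 * p.2 ^ 2)) = ∑' p : ℤ × ℤ, E (2 * (6 * p.2 - 1) ^ 2 - 5 * (6 * p.2 - 1) * p.1 +
      6 * p.1 ^ 2) := by
    rw [← τ.tsum_eq]
    refine tsum_congr fun p => congrArg E ?_
    simp only [τ, Equiv.coe_fn_mk]
    ring
  have f5 : (∑' p : ℤ × ℤ, E ((6 * p.1 + 5) ^ 2 + (6 * p.1 + 5) * p.2 + 6 * p.2 ^ 2)) =
      ∑' p : ℤ × ℤ, E ((6 * p.2 - 1) ^ 2 + (6 * p.2 - 1) * p.1 + 6 * p.1 ^ 2) := by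
    rw [← ρ.tsum_eq]
    refine tsum_congr fun p => congrArg E ?_
    simp only [ρ, Equiv.coe_fn_mk]
    ring
  have g5 : (∑' p : ℤ × ℤ, E (2 * (6 * p.1 + 5) ^ 2 - 5 * (6 * p.1 + 5) * p.2 +
      6 * p.2 ^ 2)) = ∑' p : ℤ × ℤ, E (2 * (6 * p.2 - 1) ^ 2 - 5 * (6 * p.2 - 1) * p.1 +
      6 * p.1 ^ 2) := by
    rw [← ρ.tsum_eq]
    refine tsum_congr fun p => congrArg E ?_
    simp only [ρ, Equiv.coe_fn_mk]
    ring
  have s0 := shear 0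
  have s1 := shear 1
  have s2 := shear 2
  norm_num at s0 s1 s2
  simp only [Fin.coe_ofNat_eq_mod]
  norm_num
  rw [s0, s1, s2, reflect, f1, g1, f5, g5]
  ring

lemma tsum_zpow_mul_eq_half_sub (E : ℤ → ℂ) (h : ℤ × ℤ → ℤ)
    (hh : ∀ p, 24 * h p = (6 * p.1 - 1) ^ 2 + 23 * (6 * p.2 - 1) ^ 2)
    (hE : Summable fun p : ℤ × ℤ => (-1 : ℂ) ^ p.1 * (-1) ^ p.2 * E (h p))
    (hf : Summable fun p : ℤ × ℤ => E (p.1 ^ 2 + p.1 * p.2 + 6 * p.2 ^ 2))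
    (hg : Summable fun p : ℤ × ℤ => E (2 * p.1 ^ 2 + p.1 * p.2 + 3 * p.2 ^ 2)) :
    ∑' p : ℤ × ℤ, (-1 : ℂ) ^ p.1 * (-1) ^ p.2 * E (h p) =
      ((∑' p : ℤ × ℤ, E (p.1 ^ 2 + p.1 * p.2 + 6 * p.2 ^ 2)) -
        ∑' p : ℤ × ℤ, E (2 * p.1 ^ 2 + p.1 * p.2 + 3 * p.2 ^ 2)) / 2 := by
  let κ : ℤ × ℤ ≃ ℤ × ℤ :=
    { toFun := fun p => (p.1 - p.2, -p.2)
      invFun := fun p => (p.1 - p.2, -p.2)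
      left_inv := fun p => by simp
      right_inv := fun p => by simp }
  have hκ : (fun p : ℤ × ℤ => E (2 * p.1 ^ 2 + p.1 * p.2 + 3 * p.2 ^ 2)) =
      (fun p : ℤ × ℤ => E (2 * p.1 ^ 2 - 5 * p.1 * p.2 + 6 * p.2 ^ 2)) ∘ κ := by
    funext p
    refine congrArg E ?_
    simp only [κ, Equiv.coe_fn_mk]
    ring
  rw [hκ] at hg ⊢
  simp only [Function.comp_def]
  rw [κ.tsum_eq (fun p : ℤ × ℤ => E (2 * p.1 ^ 2 - 5 * p.1 * p.2 + 6 * p.2 ^ 2)),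
    sum_tsum_sub_eq_two_mul E hf (κ.summable_iff.mp hg)]
  let σ : ℤ × ℤ ≃ ℤ × ℤ :=
    { toFun := fun p => (p.1 + p.2, p.2)
      invFun := fun p => (p.1 - p.2, p.2)
      left_inv := fun p => by simp
      right_inv := fun p => by simp }
  let ρ : ℤ × ℤ ≃ ℤ × ℤ :=
    { toFun := fun p => (p.1 - 3 * p.2, p.2)
      invFun := fun p => (p.1 + 3 * p.2, p.2)
      left_inv := fun p => by simp
      right_inv := fun p => by simp }
  have hsq : ∀ l : ℤ, (-1 : ℂ) ^ l * (-1) ^ l = 1 := fun l => by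
    rw [← mul_zpow]; simp
  have sgn : ∀ m l : ℤ, (-1 : ℂ) ^ (m + l) * (-1) ^ l = (-1) ^ m := fun m l => by
    rw [zpow_add₀ (by norm_num), mul_assoc, hsq, mul_one]
  have h24 : ∀ {a b : ℤ}, 24 * a = 24 * b → a = b := fun h => by omega
  have even : ∀ p : ℤ × ℤ, (-1 : ℂ) ^ (2 * p.1 + p.2) * (-1) ^ p.2 * E (h (2 * p.1 + p.2, p.2)) =
      E ((6 * p.2 - 1) ^ 2 + (6 * p.2 - 1) * p.1 + 6 * p.1 ^ 2) := fun p => by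
    rw [sgn, (even_two_mul p.1).neg_one_zpow, one_mul]
    refine congrArg E (h24 ?_)
    rw [hh]
    ring
  have odd : ∀ p : ℤ × ℤ, (-1 : ℂ) ^ (2 * (p.1 - 3 * p.2) + 1 + p.2) * (-1) ^ p.2 *
      E (h (2 * (p.1 - 3 * p.2) + 1 + p.2, p.2)) =
      -E (2 * (6 * p.2 - 1) ^ 2 - 5 * (6 * p.2 - 1) * p.1 + 6 * p.1 ^ 2) := fun p => by
    rw [sgn, (odd_two_mul_add_one _).neg_one_zpow, neg_one_mul]
    refine congrArg (fun n => -E n) (h24 ?_)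
    rw [hh]
    ring
  rw [← σ.tsum_eq (fun p : ℤ × ℤ => (-1 : ℂ) ^ p.1 * (-1) ^ p.2 * E (h p))]
  change ∑' p, ((fun p : ℤ × ℤ => (-1 : ℂ) ^ p.1 * (-1) ^ p.2 * E (h p)) ∘ σ) p = _
  rw [tsum_eq_sum_tsum_residues 2 (σ.summable_iff.mpr hE), Fin.sum_univ_two,
    ← ρ.tsum_eq (fun p : ℤ × ℤ => ((fun p : ℤ × ℤ => (-1 : ℂ) ^ p.1 * (-1) ^ p.2 * E (h p)) ∘ σ)
      (((2 : ℕ) : ℤ) * p.1 + ((1 : Fin 2) : ℕ), p.2))]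
  simp only [Function.comp_apply, σ, ρ, Equiv.coe_fn_mk, Nat.cast_ofNat, Fin.val_zero,
    Fin.val_one, Nat.cast_zero, Nat.cast_one, add_zero, even, odd, tsum_neg]
  ring

lemma summable_pow_toNat_of_sq_add_sq_le {q : ℂ} (hq : ‖q‖ < 1) {Q : ℤ × ℤ → ℤ}
    (hQ : ∀ p, p.1 ^ 2 + p.2 ^ 2 ≤ 2 * Q p) : Summable fun p => q ^ (Q p).toNat := by
  set s := √‖q‖ with hs
  have hs0 : 0 ≤ s := Real.sqrt_nonneg _
  have hs1 : s < 1 := by rw [hs, Real.sqrt_lt' one_pos]; simpa using hq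
  have hZ : Summable fun b : ℤ => s ^ b.natAbs := by
    refine Summable.of_nat_of_neg ?_ ?_ <;>
      simpa using summable_geometric_of_lt_one hs0 hs1
  refine (hZ.mul_of_nonneg hZ (fun _ => by positivity) fun _ => by positivity).of_norm_bounded
    fun p => ?_
  rw [norm_pow, ← Real.sq_sqrt (norm_nonneg q), ← hs, ← pow_mul, ← pow_add]
  refine pow_le_pow_of_le_one hs0 hs1.le ?_
  have h1 := Int.natAbs_le_self_sq p.1
  have h2 := Int.natAbs_le_self_sq p.2
  have h3 := hQ p
  have h4 := Int.self_le_toNat (Q p)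
  zify
  simp only [Int.natCast_natAbs] at *
  linarith

lemma hasSum_ncard_mul_pow {q : ℂ} {Q : ℤ × ℤ → ℤ} (hQ : ∀ p, 0 ≤ Q p)
    (hs : Summable fun p => q ^ (Q p).toNat) :
    HasSum (fun n : ℕ => ({p | Q p = n}.ncard : ℂ) * q ^ n) (∑' p, q ^ (Q p).toNat) := by
  have hn : ∀ n : ℕ, ∑' p : (fun p => (Q p).toNat) ⁻¹' {n}, q ^ (Q p).toNat =
      ({p | Q p = n}.ncard : ℂ) * q ^ n := fun n => by
    have hset : (fun p => (Q p).toNat) ⁻¹' {n} = {p | Q p = n} := by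
      ext p
      have := hQ p
      change (Q p).toNat = n ↔ Q p = n
      omega
    have hconst : ∀ p : (fun p => (Q p).toNat) ⁻¹' {n}, q ^ (Q p).toNat = q ^ n := fun p => by
      rw [show (Q p).toNat = n from p.2]
    rw [tsum_congr hconst, tsum_const, hset, nsmul_eq_mul, Nat.card_coe_set_eq]
  simpa only [hn] using hs.hasSum.tsum_fiberwise fun p => (Q p).toNat

/-- The product `q ∏ (1 - qⁿ) (1 - q²³ⁿ)` is the generating function of the `c n`. -/
theorem hasSum_c_mul_pow {q : ℂ} (hq : ‖q‖ < 1) :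
    HasSum (fun n : ℕ => (c n : ℂ) * q ^ n)
      (q * ((∏' n : ℕ, (1 - q ^ (n + 1))) * ∏' n : ℕ, (1 - (q ^ 23) ^ (n + 1)))) := by
  have hq' : ‖q ^ 23‖ < 1 := by
    rw [norm_pow]; exact pow_lt_one₀ (norm_nonneg q) hq (by norm_num)
  have hf := summable_pow_toNat_of_sq_add_sq_le hq
    (Q := fun p => p.1 ^ 2 + p.1 * p.2 + 6 * p.2 ^ 2) fun p => by
      nlinarith [sq_nonneg (p.1 + p.2), sq_nonneg p.2]
  have hg := summable_pow_toNat_of_sq_add_sq_le hq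
    (Q := fun p => 2 * p.1 ^ 2 + p.1 * p.2 + 3 * p.2 ^ 2) fun p => by
      nlinarith [sq_nonneg (p.1 + p.2), sq_nonneg p.2, sq_nonneg p.1]
  have hF := hasSum_ncard_mul_pow (Q := fun p => p.1 ^ 2 + p.1 * p.2 + 6 * p.2 ^ 2)
    (fun p => by nlinarith [sq_nonneg (p.1 + p.2), sq_nonneg p.2, sq_nonneg p.1]) hf
  have hG := hasSum_ncard_mul_pow (Q := fun p => 2 * p.1 ^ 2 + p.1 * p.2 + 3 * p.2 ^ 2)
    (fun p => by nlinarith [sq_nonneg (p.1 + p.2), sq_nonneg p.2, sq_nonneg p.1]) hg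
  let h : ℤ × ℤ → ℤ := fun p => pentagonal p.1 + 23 * pentagonal p.2 + 1
  have hh : ∀ p, 24 * h p = (6 * p.1 - 1) ^ 2 + 23 * (6 * p.2 - 1) ^ 2 := fun p => by
    simp only [h]
    linear_combination 12 * two_mul_natCast_pentagonal p.1 +
      276 * two_mul_natCast_pentagonal p.2
  have hterm : ∀ p : ℤ × ℤ, q * ((-1 : ℂ) ^ p.1 * q ^ pentagonal p.1 *
      ((-1 : ℂ) ^ p.2 * (q ^ 23) ^ pentagonal p.2)) =
      (-1 : ℂ) ^ p.1 * (-1) ^ p.2 * q ^ (h p).toNat := fun p => by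
    rw [show (h p).toNat = pentagonal p.1 + 23 * pentagonal p.2 + 1 by simp only [h]; omega,
      pow_add, pow_add, pow_mul, pow_one]
    ring
  have h1 := summable_neg_one_zpow_mul_pow_pentagonal hq
  have h2 := summable_neg_one_zpow_mul_pow_pentagonal hq'
  have hprod := (summable_mul_of_summable_norm h1 h2).mul_left q
  have key : q * ((∏' n : ℕ, (1 - q ^ (n + 1))) * ∏' n : ℕ, (1 - (q ^ 23) ^ (n + 1))) =
      ((∑' p : ℤ × ℤ, q ^ (p.1 ^ 2 + p.1 * p.2 + 6 * p.2 ^ 2).toNat) -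
        ∑' p : ℤ × ℤ, q ^ (2 * p.1 ^ 2 + p.1 * p.2 + 3 * p.2 ^ 2).toNat) / 2 := by
    rw [← (hasSum_neg_one_zpow_mul_pow_pentagonal hq).tsum_eq,
      ← (hasSum_neg_one_zpow_mul_pow_pentagonal hq').tsum_eq,
      tsum_mul_tsum_of_summable_norm h1 h2, ← tsum_mul_left, tsum_congr hterm]
    exact tsum_zpow_mul_eq_half_sub (fun n => q ^ n.toNat) h hh (by simpa only [hterm] using hprod)
      hf hg
  have hc : ∀ n : ℕ, (({p : ℤ × ℤ | p.1 ^ 2 + p.1 * p.2 + 6 * p.2 ^ 2 = n}.ncard : ℂ) * q ^ n -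
      ({p : ℤ × ℤ | 2 * p.1 ^ 2 + p.1 * p.2 + 3 * p.2 ^ 2 = n}.ncard : ℂ) * q ^ n) / 2 =
      (c n : ℂ) * q ^ n := fun n => by
    rw [c, r₁, r₂]
    push_cast
    ring
  rw [key]
  simpa only [hc] using (hF.sub hG).div_const 2

/-- The weight-one cusp form `η(z) η(23z)` is the generating function of the `c n`. -/
theorem hasSum_c_mul_cexp_pow {z : ℂ} (hz : 0 < z.im) :
    HasSum (fun n : ℕ => (c n : ℂ) * Complex.exp (2 * Real.pi * Complex.I * z) ^ n)
      (ModularForm.eta z * ModularForm.eta (23 * z)) := by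
  have hq : ‖Complex.exp (2 * Real.pi * Complex.I * z)‖ < 1 := by
    simpa [Function.Periodic.qParam] using
      Function.Periodic.norm_qParam_lt_one (h := 1) one_pos hz
  convert hasSum_c_mul_pow hq using 1
  simp only [ModularForm.eta, ModularForm.eta_q_eq_pow, ← Complex.exp_nat_mul _ 23]
  have h1 : Complex.exp (2 * Real.pi * Complex.I * z) =
      Function.Periodic.qParam 24 z * Function.Periodic.qParam 24 (23 * z) := by
    rw [Function.Periodic.qParam, Function.Periodic.qParam, ← Complex.exp_add]
    congr 1
    push_cast
    ring
  have h2 : 2 * Real.pi * Complex.I * (23 * z) =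
      ((23 : ℕ) : ℂ) * (2 * Real.pi * Complex.I * z) := by
    push_cast; ring
  rw [h2]
  generalize (∏' n : ℕ, (1 - Complex.exp (((23 : ℕ) : ℂ) * (2 * Real.pi * Complex.I * z)) ^ (n + 1)))
    = A
  generalize (∏' n : ℕ, (1 - Complex.exp (2 * Real.pi * Complex.I * z) ^ (n + 1))) = B
  rw [h1]
  ring

lemma exists_norm_eta_le :
    ∃ C : ℝ, ∀ z : ℂ, 0 < z.im → ‖ModularForm.eta z‖ ≤ C * z.im ^ (-(1 / 4) : ℝ) := by
  obtain ⟨C, hC⟩ := CuspFormClass.exists_bound CuspForm.discriminant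
  have hC' : ∀ z : ℂ, 0 < z.im → ‖ModularForm.eta z‖ ^ 24 ≤ C / z.im ^ 6 := fun z hz => by
    have := hC ⟨z, hz⟩
    rw [CuspForm.coe_discriminant, ModularForm.discriminant, norm_pow] at this
    convert this using 2
    rw [← Real.rpow_natCast]
    norm_num
  have hC0 : 0 ≤ C := by
    have := (by positivity : (0 : ℝ) ≤ _).trans (hC' Complex.I (by simp))
    simpa using this
  refine ⟨C ^ (1 / 24 : ℝ), fun z hz => ?_⟩
  refine le_of_pow_le_pow_left₀ (n := 24) (by norm_num) (by positivity) ((hC' z hz).trans_eq ?_)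
  rw [mul_pow, ← Real.rpow_mul_natCast hC0, ← Real.rpow_mul_natCast hz.le]
  norm_num
  rw [div_eq_mul_inv]

lemma exists_norm_eta_mul_eta_le : ∃ C : ℝ, ∀ z : ℂ, 0 < z.im →
    ‖ModularForm.eta z * ModularForm.eta (23 * z)‖ ≤ C * z.im ^ (-(1 / 2) : ℝ) := by
  obtain ⟨C, hC⟩ := exists_norm_eta_le
  refine ⟨C * (C * 23 ^ (-(1 / 4) : ℝ)), fun z hz => ?_⟩
  have him : (23 * z).im = 23 * z.im := by simp
  have h1 := hC z hz
  have h2 := hC (23 * z) (by rw [him]; positivity)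
  rw [him, Real.mul_rpow (by norm_num) hz.le] at h2
  rw [norm_mul]
  refine (mul_le_mul h1 h2 (norm_nonneg _) ((norm_nonneg _).trans h1)).trans_eq ?_
  rw [show (-(1 / 2) : ℝ) = -(1 / 4) + -(1 / 4) by norm_num, Real.rpow_add hz]
  ring

lemma cexp_pow_eq_exp_mul_e (x y : ℝ) (n : ℕ) :
    Complex.exp (2 * Real.pi * Complex.I * (x + y * Complex.I)) ^ n =
      (Real.exp (-(2 * Real.pi * n * y)) : ℂ) * e (n * x) := by
  rw [e, Complex.ofReal_exp, ← Complex.exp_add, ← Complex.exp_nat_mul]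
  congr 1
  push_cast
  linear_combination (2 * Real.pi * n * y : ℂ) * Complex.I_sq

/-- The series `∑_{n ≥ 1} (c_n/n) e(nx)` converges uniformly to a continuous
1-periodic function which is Hölder continuous of every index `β < 1/2`. -/
theorem stmt_15 :
    ∃ φ : ℝ → ℂ,
      TendstoUniformly
        (fun N x => ∑ n ∈ Finset.Icc 1 N, ((c n : ℂ) / (n : ℂ)) * e ((n : ℝ) * x))
        φ Filter.atTop ∧
      Continuous φ ∧ Function.Periodic φ 1 ∧
      ∀ β : ℝ, 0 < β → β < 1/2 → ∃ C > (0:ℝ), ∀ x y : ℝ,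
        ‖φ x - φ y‖ ≤ C * |x - y| ^ β := by
  refine exists_tendstoUniformly_of_partial_sums_le (fun n => (c n : ℂ)) fun β h0 h1 => ?_
  obtain ⟨C, hC⟩ := exists_norm_eta_mul_eta_le
  have hz : ∀ x y : ℝ, 0 < y → HasSum
      (fun n : ℕ => (c n : ℂ) * (Real.exp (-(2 * Real.pi * n * y)) : ℂ) * e (n * x))
      (ModularForm.eta (x + y * Complex.I) * ModularForm.eta (23 * (x + y * Complex.I))) :=
    fun x y hy => by
      have h := hasSum_c_mul_cexp_pow (z := x + y * Complex.I) (by simpa using hy)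
      simpa only [cexp_pow_eq_exp_mul_e, ← mul_assoc] using h
  have hs : ∀ y : ℝ, 0 < y → Summable fun n : ℕ =>
      ‖(c n : ℂ)‖ * Real.exp (-(2 * Real.pi * n * y)) := fun y hy => by
    refine (hz 0 y hy).summable.norm.congr fun n => ?_
    rw [norm_mul, norm_mul, norm_e, mul_one, Complex.norm_real, Complex.norm_real,
      Real.norm_of_nonneg (Real.exp_pos _).le]
  have hb : ∀ y : ℝ, 0 < y → ∀ x : ℝ,
      ‖∑' n : ℕ, (c n : ℂ) * (Real.exp (-(2 * Real.pi * n * y)) : ℂ) * e (n * x)‖ ≤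
        C * y ^ (-(1 / 2) : ℝ) := fun y hy x => by
    rw [(hz x y hy).tsum_eq]
    simpa using hC (x + y * Complex.I) (by simpa using hy)
  obtain ⟨K, hK⟩ := norm_partial_sum_le hs hb (δ := 1 / 2 - β) (by linarith) (by linarith)
  rw [show 1 / 2 + (1 / 2 - β) = 1 - β by ring] at hK
  exact ⟨K, hK⟩
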